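/- Assume e = N = 3, p ≡ 2 (mod 3) (the case p = 2 is allowed), and 3 does not divide (q−1)/h. Then ms is even, and setting ε = (−1)^{ms/2} p^{ms/2} (= (−1)^{ms/2}√r), the modified weight λ(a,b), as (a,b) ranges over GF(r)², takes only the values −h(2ε+1)/q, h(ε−1)/q, −h(ε+1)/q, −h/q, h(r+2ε−3)/(3q), h(r−ε−3)/(3q), h(r−1)/q; and for every real number x, the number of pairs (a,b) ∈ GF(r)² with λ(a,b) = x equals the sum of the following frequencies over those listed values that equal x: value −h(2ε+1)/q with frequency (r−1)(r+1−2ε)/27; value h(ε−1)/q with frequency 2(r−1)(4r−5+ε)/27; value −h(ε+1)/q with frequency 2(r−1)(r−2+ε)/9; value −h/q with frequency (r−1)(4r−11−2ε)/9; value h(r+2ε−3)/(3q) with frequency r−1; value h(r−ε−3)/(3q) with frequency 2(r−1); value h(r−1)/q with frequency 1. -/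

import Mathlib

open scoped Classical

/-- Two homomorphisms of finite commutative groups with the same range have the same averages. -/
lemma card_mul_sum_comp_eq_of_range_eq {G₁ G₂ H : Type*} [CommGroup G₁] [CommGroup G₂]
    [CommGroup H] [Fintype G₁] [Fintype G₂] (φ₁ : G₁ →* H) (φ₂ : G₂ →* H)
    (hrange : φ₁.range = φ₂.range) (f : H → ℂ) :
    (Fintype.card G₂ : ℂ) * ∑ x, f (φ₁ x) = Fintype.card G₁ * ∑ x, f (φ₂ x) := by
  have h₁ : ∀ y : G₂, ∑ x, f (φ₁ x * φ₂ y) = ∑ x, f (φ₁ x) := by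
    intro y
    obtain ⟨x₀, hx₀⟩ : φ₂ y ∈ φ₁.range := hrange ▸ ⟨y, rfl⟩
    rw [← hx₀]
    simp_rw [← map_mul]
    exact Equiv.sum_comp (Equiv.mulRight x₀) fun x => f (φ₁ x)
  have h₂ : ∀ x : G₁, ∑ y, f (φ₁ x * φ₂ y) = ∑ y, f (φ₂ y) := by
    intro x
    obtain ⟨y₀, hy₀⟩ : φ₁ x ∈ φ₂.range := hrange ▸ ⟨x, rfl⟩
    rw [← hy₀]
    simp_rw [← map_mul]
    exact Equiv.sum_comp (Equiv.mulLeft y₀) fun x => f (φ₂ x)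
  have h := Finset.sum_comm (s := (Finset.univ : Finset G₁)) (t := (Finset.univ : Finset G₂))
    (f := fun x y => f (φ₁ x * φ₂ y))
  simp_rw [h₁, h₂] at h
  simpa using h.symm

/-- Additive characters of a tower of finite fields, compatible with the trace and invariant
under the Frobenius. -/
lemma exists_primitive_addChar_frobenius_invariant (K F : Type) [Field K] [Field F] [Algebra K F]
    [Fintype K] [Fintype F] (p : ℕ) [Fact p.Prime] [CharP K p] [CharP F p] :
    ∃ (ψ : AddChar K ℂ) (χ : AddChar F ℂ), ψ.IsPrimitive ∧ χ.IsPrimitive ∧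
      (∀ x, χ x = ψ (Algebra.trace K F x)) ∧ ∀ x, χ (x ^ p) = χ x := by
  let _ : Algebra (ZMod p) K := ZMod.algebra _ _
  let _ : Algebra (ZMod p) F := ZMod.algebra _ _
  have : IsScalarTower (ZMod p) K F := IsScalarTower.of_algebraMap_eq' (Subsingleton.elim _ _)
  have hroot := Complex.isPrimitiveRoot_exp p (Fact.out : p.Prime).ne_zero
  let ψ₀ : AddChar (ZMod p) ℂ := AddChar.zmodChar p hroot.pow_eq_one
  have hψ₀ : ψ₀.IsPrimitive := AddChar.zmodChar_primitive_of_primitive_root p hroot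
  have key : ∀ (L : Type) [Field L] [Fintype L] [Algebra (ZMod p) L],
      (ψ₀.compAddMonoidHom (Algebra.trace (ZMod p) L).toAddMonoidHom).IsPrimitive := by
    intro L _ _ _
    apply AddChar.IsPrimitive.of_ne_one
    obtain ⟨a, ha⟩ := Algebra.trace_surjective (ZMod p) L 1
    refine AddChar.ne_one_iff.2 ⟨a, fun hf => ?_⟩
    have := (hψ₀.zmod_char_eq_one_iff p _).mp hf
    exact one_ne_zero (ha.symm.trans this)
  refine ⟨_, _, key K, key F, fun x => ?_, fun x => ?_⟩
  · change ψ₀ (Algebra.trace (ZMod p) F x) = ψ₀ (Algebra.trace (ZMod p) K (Algebra.trace K F x))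
    rw [Algebra.trace_trace]
  · change ψ₀ (Algebra.trace (ZMod p) F (x ^ p)) = ψ₀ (Algebra.trace (ZMod p) F x)
    have := Algebra.trace_eq_of_algEquiv (FiniteField.frobeniusAlgEquivOfAlgebraic (ZMod p) F) x
    simp [ZMod.card] at this
    rw [this]

/-- The nonzero cubes of a field. -/
def IsNonzeroCube {F : Type} [Field F] (x : F) : Prop := ∃ y : Fˣ, ((y ^ 3 : Fˣ) : F) = x

section Cubes

variable {F : Type} [Field F]

lemma IsNonzeroCube.ne_zero {x : F} (hx : IsNonzeroCube x) : x ≠ 0 := by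
  obtain ⟨y, rfl⟩ := hx
  exact Units.ne_zero _

lemma IsNonzeroCube.mul_iff {c : F} (hc : IsNonzeroCube c) (x : F) :
    IsNonzeroCube (c * x) ↔ IsNonzeroCube x := by
  obtain ⟨t, rfl⟩ := hc
  constructor
  · rintro ⟨y, hy⟩
    refine ⟨t⁻¹ * y, ?_⟩
    rw [mul_pow, Units.val_mul, hy, ← mul_assoc, ← Units.val_mul, ← mul_pow]
    simp
  · rintro ⟨y, rfl⟩
    exact ⟨t * y, by rw [mul_pow, Units.val_mul]⟩

lemma isNonzeroCube_neg_one : IsNonzeroCube (-1 : F) :=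
  ⟨-1, by simp [Odd.neg_one_pow (n := 3) (by decide)]⟩

lemma isNonzeroCube_neg_iff (x : F) : IsNonzeroCube (-x) ↔ IsNonzeroCube x := by
  rw [← isNonzeroCube_neg_one.mul_iff x, neg_one_mul]

variable [Fintype F] {α : Fˣ}

lemma exists_eq_generator_pow (hα : ∀ x : Fˣ, x ∈ Subgroup.zpowers α) {x : F} (hx : x ≠ 0) :
    ∃ i : ℕ, x = (α : F) ^ i := by
  obtain ⟨i, hi⟩ := (mem_powers_iff_mem_zpowers (x := α)).2 (hα (Units.mk0 x hx))
  exact ⟨i, by simpa using (congrArg Units.val hi).symm⟩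

lemma orderOf_generator (hα : ∀ x : Fˣ, x ∈ Subgroup.zpowers α) : orderOf α = Fintype.card F - 1 := by
  rw [orderOf_eq_card_of_forall_mem_zpowers hα, Nat.card_eq_fintype_card, Fintype.card_units]

lemma isNonzeroCube_generator_pow (hα : ∀ x : Fˣ, x ∈ Subgroup.zpowers α) 
    (h3 : 3 ∣ Fintype.card F - 1) (i : ℕ) :
    IsNonzeroCube ((α : F) ^ i) ↔ 3 ∣ i := by
  constructor
  · rintro ⟨y, hy⟩
    obtain ⟨j, rfl⟩ := (mem_powers_iff_mem_zpowers (x := α)).2 (hα y)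
    have hy' : α ^ (j * 3) = α ^ i := by
      apply Units.ext
      simpa [pow_mul] using hy
    rw [pow_eq_pow_iff_modEq, orderOf_generator hα] at hy'
    exact ((hy'.of_dvd h3).dvd_iff dvd_rfl).1 (Dvd.intro_left _ rfl)
  · rintro ⟨j, rfl⟩
    exact ⟨α ^ j, by rw [← pow_mul, mul_comm]; simp⟩

end Cubes

section Fourier

variable {F : Type} [Field F] [Fintype F] {χ : AddChar F ℂ}

lemma sum_sum_mul_addChar (hχ : χ.IsPrimitive) (f : F → ℂ) :
    ∑ z, ∑ x, f x * χ (z * x) = Fintype.card F * f 0 := by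
  rw [Finset.sum_comm]
  simp_rw [← Finset.mul_sum, AddChar.sum_mulShift _ hχ]
  simp [mul_comm]

lemma fourier_mul_fourier (χ : AddChar F ℂ) (f₀ f₁ : F → ℂ) (z : F) :
    (∑ x, f₀ x * χ (z * x)) * (∑ x, f₁ x * χ (z * x)) =
      ∑ x, (∑ y, f₀ y * f₁ (x - y)) * χ (z * x) := by
  simp_rw [Finset.sum_mul]
  rw [Finset.sum_comm]
  refine Finset.sum_congr rfl fun x _ => ?_
  rw [Finset.mul_sum, ← Equiv.sum_comp (Equiv.subRight x)]
  refine Finset.sum_congr rfl fun y _ => ?_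
  rw [Equiv.subRight_apply, show z * y = z * x + z * (y - x) by ring, AddChar.map_add_eq_mul]
  ring

lemma sum_fourier_mul_fourier (hχ : χ.IsPrimitive) (f₀ f₁ : F → ℂ) :
    ∑ z, (∑ x, f₀ x * χ (z * x)) * (∑ x, f₁ x * χ (z * x)) =
      Fintype.card F * ∑ x, f₀ x * f₁ (-x) := by
  simp_rw [fourier_mul_fourier]
  rw [sum_sum_mul_addChar hχ fun x => ∑ y, f₀ y * f₁ (x - y)]
  simp

lemma sum_fourier_mul_fourier_mul_fourier (hχ : χ.IsPrimitive) (f₀ f₁ f₂ : F → ℂ) :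
    ∑ z, (∑ x, f₀ x * χ (z * x)) * (∑ x, f₁ x * χ (z * x)) * (∑ x, f₂ x * χ (z * x)) =
      Fintype.card F * ∑ w : F × F, f₀ w.1 * f₁ w.2 * f₂ (-w.1 - w.2) := by
  simp_rw [mul_assoc, fourier_mul_fourier χ f₁ f₂]
  rw [sum_fourier_mul_fourier hχ f₀ fun x => ∑ y, f₁ y * f₂ (x - y), Fintype.sum_prod_type]
  simp_rw [Finset.mul_sum]

end Fourier

/-- The indicator function of the nonzero cubes. -/
noncomputable def cubeIndicator {F : Type} [Field F] (x : F) : ℝ :=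
  if IsNonzeroCube x then 1 else 0

lemma cubeIndicator_congr {F : Type} [Field F] {x y : F} (h : IsNonzeroCube x ↔ IsNonzeroCube y) :
    cubeIndicator x = cubeIndicator y := by
  simp [cubeIndicator, h]

lemma cubeIndicator_zero {F : Type} [Field F] : cubeIndicator (0 : F) = 0 :=
  if_neg fun h => h.ne_zero rfl

/-- The Gaussian period `∑ χ (x * t)`, with `t` ranging over the nonzero cubes. -/
noncomputable def cubicPeriod {F : Type} [Field F] [Fintype F] (χ : AddChar F ℂ) (x : F) : ℂ :=
  ∑ t, (cubeIndicator t : ℂ) * χ (x * t)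

/-- The value of the cubic Gaussian period at `x` in the semiprimitive case. -/
noncomputable def cubicPeriodValue {F : Type} [Field F] [Fintype F] (ε : ℝ) (x : F) : ℝ :=
  if x = 0 then ((Fintype.card F : ℝ) - 1) / 3
  else if IsNonzeroCube x then (-1 - 2 * ε) / 3 else (ε - 1) / 3

section Periods

variable {F : Type} [Field F] [Fintype F] {α : Fˣ}

lemma three_mul_sum_of_shift_sum_const {R : Type*} [CommRing R] (f : F → R) (c : R)
    (hf : ∀ x : F, x ≠ 0 → f x + f (α * x) + f (α ^ 2 * x) = c) :
    3 * ∑ x, f x = 3 * f 0 + (Fintype.card F - 1) * c := by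
  have h₁ : ∑ x, f (α * x) = ∑ x, f x := Equiv.sum_comp (Equiv.mulLeft₀ (α : F) α.ne_zero) f
  have h₂ : ∑ x, f (α ^ 2 * x) = ∑ x, f x :=
    Equiv.sum_comp (Equiv.mulLeft₀ ((α : F) ^ 2) (pow_ne_zero _ α.ne_zero)) f
  have h₃ : ∑ x, (f x + f (α * x) + f (α ^ 2 * x)) = 3 * ∑ x, f x := by
    rw [Finset.sum_add_distrib, Finset.sum_add_distrib, h₁, h₂]
    ring
  have h₄ : ∀ x : F, f x + f (α * x) + f (α ^ 2 * x) = c + if x = 0 then 3 * f 0 - c else 0 := by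
    intro x
    split_ifs with hx
    · subst hx
      simp
      ring
    · rw [hf x hx, add_zero]
  rw [← h₃]
  simp_rw [h₄]
  rw [Finset.sum_add_distrib]
  simp
  ring

lemma cubeIndicator_shift_sum (hα : ∀ x : Fˣ, x ∈ Subgroup.zpowers α)
    (h3 : 3 ∣ Fintype.card F - 1) {x : F} (hx : x ≠ 0) :
    cubeIndicator x + cubeIndicator (α * x) + cubeIndicator (α ^ 2 * x) = 1 := by
  obtain ⟨i, rfl⟩ := exists_eq_generator_pow hα hx
  rw [← pow_succ', ← pow_add]
  simp only [cubeIndicator, isNonzeroCube_generator_pow hα h3]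
  have : i % 3 = 0 ∨ i % 3 = 1 ∨ i % 3 = 2 := by omega
  rcases this with h | h | h
  · rw [if_pos (by omega), if_neg (by omega), if_neg (by omega)]; norm_num
  · rw [if_neg (by omega), if_neg (by omega), if_pos (by omega)]; norm_num
  · rw [if_neg (by omega), if_pos (by omega), if_neg (by omega)]; norm_num

lemma sum_cubeIndicator (hα : ∀ x : Fˣ, x ∈ Subgroup.zpowers α)
    (h3 : 3 ∣ Fintype.card F - 1) :
    ∑ x : F, cubeIndicator x = ((Fintype.card F : ℝ) - 1) / 3 := by
  have := three_mul_sum_of_shift_sum_const (α := α) (cubeIndicator : F → ℝ) 1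
    fun x hx => cubeIndicator_shift_sum hα h3 hx
  rw [cubeIndicator_zero] at this
  linarith

lemma cubicPeriod_mul_cube (χ : AddChar F ℂ) {c : F} (hc : IsNonzeroCube c) (x : F) :
    cubicPeriod χ (c * x) = cubicPeriod χ x := by
  unfold cubicPeriod
  refine Fintype.sum_equiv (Equiv.mulLeft₀ c hc.ne_zero) _ _ fun t => ?_
  change _ = (cubeIndicator (c * t) : ℂ) * χ (x * (c * t))
  rw [cubeIndicator_congr (hc.mul_iff t)]
  ring_nf

lemma cubicPeriod_pow_char {p : ℕ} [Fact p.Prime] [CharP F p] {χ : AddChar F ℂ}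
    (hfrob : ∀ x, χ (x ^ p) = χ x) (hp : ¬ 3 ∣ p) (hα : ∀ x : Fˣ, x ∈ Subgroup.zpowers α)
    (h3 : 3 ∣ Fintype.card F - 1) (x : F) : cubicPeriod χ (x ^ p) = cubicPeriod χ x := by
  unfold cubicPeriod
  symm
  refine Fintype.sum_equiv (frobeniusEquiv F p).toEquiv _ _ fun t => ?_
  have hcube : IsNonzeroCube (t ^ p) ↔ IsNonzeroCube t := by
    by_cases ht : t = 0
    · rw [ht, zero_pow (Fact.out : p.Prime).ne_zero]
    · obtain ⟨i, rfl⟩ := exists_eq_generator_pow hα ht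
      rw [← pow_mul, isNonzeroCube_generator_pow hα h3, isNonzeroCube_generator_pow hα h3,
        Nat.prime_three.dvd_mul]
      tauto
  change _ = (cubeIndicator (t ^ p) : ℂ) * χ (x ^ p * t ^ p)
  rw [cubeIndicator_congr hcube, ← mul_pow, hfrob]

lemma cubicPeriod_zero (χ : AddChar F ℂ) (hα : ∀ x : Fˣ, x ∈ Subgroup.zpowers α)
    (h3 : 3 ∣ Fintype.card F - 1) :
    cubicPeriod χ 0 = ((((Fintype.card F : ℝ) - 1) / 3 : ℝ) : ℂ) := by
  rw [← sum_cubeIndicator hα h3]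
  simp [cubicPeriod]

lemma isIntegral_cubicPeriod {p : ℕ} [Fact p.Prime] [CharP F p] (χ : AddChar F ℂ) (x : F) :
    IsIntegral ℤ (cubicPeriod χ x) := by
  refine IsIntegral.sum _ fun t _ => IsIntegral.mul ?_ ?_
  · unfold cubeIndicator
    split_ifs
    · simpa using isIntegral_one
    · simpa using isIntegral_zero
  · refine IsIntegral.of_pow (Fact.out : p.Prime).pos ?_
    rw [← AddChar.map_nsmul_eq_pow]
    simpa using isIntegral_one

lemma exists_int_of_isIntegral_complex {x : ℂ} (hx : IsIntegral ℤ x) {a : ℤ} {b : ℤ} (hb : b ≠ 0)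
    (h : x * b = a) : b ∣ a := by
  have hb' : (b : ℂ) ≠ 0 := by exact_mod_cast hb
  have hxq : x = algebraMap ℚ ℂ ((a : ℚ) / b) := by
    simp
    field_simp
    exact h
  rw [hxq, isIntegral_algebraMap_iff (algebraMap ℚ ℂ).injective] at hx
  obtain ⟨c, hc⟩ := IsIntegrallyClosed.isIntegral_iff.1 hx
  refine ⟨c, ?_⟩
  have hbq : (b : ℚ) ≠ 0 := by exact_mod_cast hb
  have : (a : ℚ) = b * c := by
    simp at hc
    field_simp at hc
    linarith
  exact_mod_cast this

/-- Evaluation of the cubic Gaussian periods in the semiprimitive case. -/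
lemma cubicPeriod_eq_value {p : ℕ} [Fact p.Prime] [CharP F p] {χ : AddChar F ℂ}
    (hχ : χ.IsPrimitive) (hfrob : ∀ x, χ (x ^ p) = χ x) (hp : p % 3 = 2)
    (hα : ∀ x : Fˣ, x ∈ Subgroup.zpowers α) (h3 : 3 ∣ Fintype.card F - 1)
    {ε : ℤ} (hε : ε ^ 2 = Fintype.card F) (hε3 : ε % 3 = 1) (x : F) :
    cubicPeriod χ x = (cubicPeriodValue (ε : ℝ) x : ℂ) := by
  set A := cubicPeriod χ 1 with hA
  set B := cubicPeriod χ (α : F) with hB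
  have hpow : ∀ i j : ℕ, i % 3 = j % 3 →
      cubicPeriod χ ((α : F) ^ i) = cubicPeriod χ ((α : F) ^ j) := by
    have hbase : ∀ i : ℕ, cubicPeriod χ ((α : F) ^ i) = cubicPeriod χ ((α : F) ^ (i % 3)) := by
      intro i
      conv_lhs => rw [← Nat.div_add_mod i 3, pow_add]
      exact cubicPeriod_mul_cube χ
        ((isNonzeroCube_generator_pow hα h3 _).2 (Nat.dvd_mul_right _ _)) _
    intro i j hij
    rw [hbase i, hbase j, hij]
  have hC : cubicPeriod χ ((α : F) ^ 2) = B := by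
    rw [hpow 2 p (by omega), cubicPeriod_pow_char hfrob (by omega) hα h3]
  have hcube : ∀ i : ℕ, 3 ∣ i → cubicPeriod χ ((α : F) ^ i) = A := by
    intro i hi
    rw [hpow i 0 (by omega), pow_zero]
  have hnoncube : ∀ i : ℕ, ¬ 3 ∣ i → cubicPeriod χ ((α : F) ^ i) = B := by
    intro i hi
    have : i % 3 = 1 ∨ i % 3 = 2 := by omega
    rcases this with h | h
    · rw [hpow i 1 (by omega), pow_one]
    · rw [hpow i 2 (by omega), hC]
  have hshift : ∀ f : ℂ → ℂ, ∀ x : F, x ≠ 0 → f (cubicPeriod χ x) + f (cubicPeriod χ (α * x)) +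
      f (cubicPeriod χ (α ^ 2 * x)) = f A + 2 * f B := by
    intro f x hx
    obtain ⟨i, rfl⟩ := exists_eq_generator_pow hα hx
    rw [← pow_succ', ← pow_add]
    have : i % 3 = 0 ∨ i % 3 = 1 ∨ i % 3 = 2 := by omega
    rcases this with h | h | h
    · rw [hcube i (by omega), hnoncube _ (by omega), hnoncube _ (by omega)]; ring
    · rw [hnoncube i (by omega), hnoncube _ (by omega), hcube _ (by omega)]; ring
    · rw [hnoncube i (by omega), hcube _ (by omega), hnoncube _ (by omega)]; ring
  have hr1 : ((Fintype.card F : ℂ) - 1) ≠ 0 := by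
    have := Fintype.one_lt_card (α := F)
    rw [sub_ne_zero]
    exact_mod_cast this.ne'
  have hr0 : (Fintype.card F : ℂ) ≠ 0 := by
    exact_mod_cast Fintype.card_ne_zero
  have hzero := cubicPeriod_zero χ hα h3
  push_cast at hzero
  have hsum : A + 2 * B = -1 := by
    have h₁ := three_mul_sum_of_shift_sum_const (α := α) (cubicPeriod χ) _ (hshift id)
    have h₂ := sum_sum_mul_addChar hχ fun t : F => (cubeIndicator t : ℂ)
    rw [cubeIndicator_zero] at h₂
    simp only [id] at h₁
    rw [show ∑ x, cubicPeriod χ x = 0 by simpa [cubicPeriod] using h₂, hzero] at h₁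
    refine mul_left_cancel₀ hr1 ?_
    linear_combination -h₁
  have hsumsq : 3 * (A ^ 2 + 2 * B ^ 2) = 2 * Fintype.card F + 1 := by
    have h₁ := three_mul_sum_of_shift_sum_const (α := α) (fun x => cubicPeriod χ x ^ 2) _
      (hshift (· ^ 2))
    have h₂ := sum_fourier_mul_fourier hχ (fun t : F => (cubeIndicator t : ℂ))
      fun t : F => (cubeIndicator t : ℂ)
    have h₃ : ∀ x : F, (cubeIndicator x : ℂ) * cubeIndicator (-x) = (cubeIndicator x : ℝ) := by
      intro x
      rw [cubeIndicator_congr (isNonzeroCube_neg_iff x)]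
      unfold cubeIndicator
      split_ifs <;> simp
    simp_rw [h₃] at h₂
    rw [← Complex.ofReal_sum, sum_cubeIndicator hα h3] at h₂
    have h₄ : ∑ x, cubicPeriod χ x ^ 2 = Fintype.card F * (((Fintype.card F : ℂ) - 1) / 3) := by
      simp_rw [sq]
      push_cast at h₂
      exact h₂
    rw [h₄, hzero] at h₁
    refine mul_left_cancel₀ hr1 ?_
    linear_combination -3 * h₁
  have hεc : (ε : ℂ) ^ 2 = Fintype.card F := by exact_mod_cast hε
  have hBsq : (3 * B + 1) ^ 2 = (ε : ℂ) ^ 2 := by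
    have hA' : A = -1 - 2 * B := by linear_combination hsum
    rw [hA'] at hsumsq
    rw [hεc]
    linear_combination hsumsq / 2
  have hBval : 3 * B + 1 = ε := by
    rcases sq_eq_sq_iff_eq_or_eq_neg.1 hBsq with h | h
    · exact h
    · exfalso
      have := exists_int_of_isIntegral_complex (isIntegral_cubicPeriod (p := p) χ (α : F))
        (a := -ε - 1) (b := 3) (by norm_num) (by push_cast; linear_combination h)
      omega
  unfold cubicPeriodValue
  split_ifs with hx hx'
  · rw [hx, cubicPeriod_zero χ hα h3]
  · obtain ⟨i, rfl⟩ := exists_eq_generator_pow hα hx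
    rw [hcube i ((isNonzeroCube_generator_pow hα h3 i).1 hx')]
    push_cast
    linear_combination hsum - 2 / 3 * hBval
  · obtain ⟨i, rfl⟩ := exists_eq_generator_pow hα hx
    rw [hnoncube i (mt (isNonzeroCube_generator_pow hα h3 i).2 hx')]
    push_cast
    linear_combination hBval / 3

end Periods

section Counting

/-- The states of the three summands are encoded by the `d i` (vanishing) and `u i` (cube). -/
lemma apply_sum_periods_eq (Φ : ℝ → ℝ) (r ε d₀ d₁ d₂ u₀ u₁ u₂ : ℝ)
    (h₀ : (d₀ = 0 ∧ u₀ = 0) ∨ (d₀ = 0 ∧ u₀ = 1) ∨ (d₀ = 1 ∧ u₀ = 0))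
    (h₁ : (d₁ = 0 ∧ u₁ = 0) ∨ (d₁ = 0 ∧ u₁ = 1) ∨ (d₁ = 1 ∧ u₁ = 0))
    (h₂ : (d₂ = 0 ∧ u₂ = 0) ∨ (d₂ = 0 ∧ u₂ = 1) ∨ (d₂ = 1 ∧ u₂ = 0))
    (hd₁ : d₀ * d₁ = d₀ * d₂) (hd₂ : d₀ * d₁ = d₁ * d₂)
    (hu₀ : d₀ * (u₁ * u₂) = 0) (hu₁ : d₁ * (u₀ * u₂) = 0) (hu₂ : d₂ * (u₀ * u₁) = 0) :
    Φ ((d₀ * ((r - 1) / 3) + u₀ * ((-1 - 2 * ε) / 3) + (1 - d₀ - u₀) * ((ε - 1) / 3)) +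
       (d₁ * ((r - 1) / 3) + u₁ * ((-1 - 2 * ε) / 3) + (1 - d₁ - u₁) * ((ε - 1) / 3)) +
       (d₂ * ((r - 1) / 3) + u₂ * ((-1 - 2 * ε) / 3) + (1 - d₂ - u₂) * ((ε - 1) / 3))) =
      (u₀ * u₁ * u₂) * Φ (-1 - 2 * ε) +
      (1 - (u₀ + u₁ + u₂) + (u₀ * u₁ + u₀ * u₂ + u₁ * u₂) - u₀ * u₁ * u₂
        - (d₀ + d₁ + d₂) + 2 * (d₀ * d₁) +
        (d₀ * u₁ + d₀ * u₂ + d₁ * u₀ + d₁ * u₂ + d₂ * u₀ + d₂ * u₁)) * Φ (ε - 1) +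
      (u₀ * u₁ + u₀ * u₂ + u₁ * u₂ - 3 * (u₀ * u₁ * u₂)) * Φ (-1 - ε) +
      (u₀ + u₁ + u₂ - 2 * (u₀ * u₁ + u₀ * u₂ + u₁ * u₂) + 3 * (u₀ * u₁ * u₂)
        - (d₀ * u₁ + d₀ * u₂ + d₁ * u₀ + d₁ * u₂ + d₂ * u₀ + d₂ * u₁)) * Φ (-1) +
      (d₀ + d₁ + d₂ - 3 * (d₀ * d₁) -
        (d₀ * u₁ + d₀ * u₂ + d₁ * u₀ + d₁ * u₂ + d₂ * u₀ + d₂ * u₁)) * Φ ((r + 2 * ε - 3) / 3) +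
      (d₀ * u₁ + d₀ * u₂ + d₁ * u₀ + d₁ * u₂ + d₂ * u₀ + d₂ * u₁) * Φ ((r - ε - 3) / 3) +
      (d₀ * d₁) * Φ (r - 1) := by
  rcases h₀ with ⟨rfl, rfl⟩ | ⟨rfl, rfl⟩ | ⟨rfl, rfl⟩ <;>
  rcases h₁ with ⟨rfl, rfl⟩ | ⟨rfl, rfl⟩ | ⟨rfl, rfl⟩ <;>
  rcases h₂ with ⟨rfl, rfl⟩ | ⟨rfl, rfl⟩ | ⟨rfl, rfl⟩ <;>
  first
  | (exfalso; linarith)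
  | ring_nf

/-- The indicator function of zero. -/
noncomputable def zeroIndicator {F : Type} [Field F] (x : F) : ℝ := if x = 0 then 1 else 0

lemma indicator_cases {F : Type} [Field F] (x : F) : (zeroIndicator x = 0 ∧ cubeIndicator x = 0) ∨
    (zeroIndicator x = 0 ∧ cubeIndicator x = 1) ∨
    (zeroIndicator x = 1 ∧ cubeIndicator x = 0) := by
  by_cases hx : x = 0
  · right; right
    exact ⟨if_pos hx, by rw [hx, cubeIndicator_zero]⟩
  · by_cases hx' : IsNonzeroCube x
    · exact Or.inr (Or.inl ⟨if_neg hx, if_pos hx'⟩)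
    · exact Or.inl ⟨if_neg hx, if_neg hx'⟩

lemma zeroIndicator_mul_left {F : Type} [Field F] {c : F} (hc : c ≠ 0) (x : F) :
    zeroIndicator (c * x) = zeroIndicator x := by
  simp [zeroIndicator, hc]

lemma sum_prod_mul_fst_snd {F : Type} [Fintype F] (f₀ f₁ : F → ℝ) :
    ∑ w : F × F, f₀ w.1 * f₁ w.2 = (∑ x, f₀ x) * ∑ x, f₁ x := by
  rw [Fintype.sum_prod_type, Finset.sum_mul_sum]

variable {F : Type} [Field F] [Fintype F]

lemma sum_prod_mul_fst_neg (f₀ f₂ : F → ℝ) :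
    ∑ w : F × F, f₀ w.1 * f₂ (-w.1 - w.2) = (∑ x, f₀ x) * ∑ x, f₂ x := by
  rw [Fintype.sum_prod_type, Finset.sum_mul_sum]
  exact Finset.sum_congr rfl fun x _ =>
    Equiv.sum_comp (Equiv.subLeft (-x)) fun y => f₀ x * f₂ y

lemma sum_prod_mul_snd_neg (f₁ f₂ : F → ℝ) :
    ∑ w : F × F, f₁ w.2 * f₂ (-w.1 - w.2) = (∑ x, f₁ x) * ∑ x, f₂ x := by
  rw [← sum_prod_mul_fst_neg, ← Equiv.sum_comp (Equiv.prodComm F F)]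
  refine Finset.sum_congr rfl fun w _ => ?_
  simp only [Equiv.prodComm_apply, Prod.fst_swap, Prod.snd_swap]
  rw [neg_sub_comm]

lemma sum_zeroIndicator : ∑ x : F, zeroIndicator x = 1 := by
  simp [zeroIndicator]

lemma cubicPeriodValue_eq (ε : ℝ) (x : F) :
    cubicPeriodValue ε x = zeroIndicator x * (((Fintype.card F : ℝ) - 1) / 3) +
      cubeIndicator x * ((-1 - 2 * ε) / 3) +
      (1 - zeroIndicator x - cubeIndicator x) * ((ε - 1) / 3) := by
  unfold cubicPeriodValue zeroIndicator
  split_ifs with h h'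
  · rw [h, cubeIndicator_zero]; ring
  · rw [cubeIndicator, if_pos h']; ring
  · rw [cubeIndicator, if_neg h']; ring

lemma sum_comp_mul_left {c : F} (hc : c ≠ 0) (f : F → ℝ) : ∑ x, f (c * x) = ∑ x, f x :=
  Equiv.sum_comp (Equiv.mulLeft₀ c hc) f

/-- Solutions of `w.1 + w.2 + x = 0` with `w.1`, `g * w.2` and `g ^ 2 * x` nonzero cubes. -/
lemma sum_cubeIndicator_triple {α : Fˣ} {p : ℕ} [Fact p.Prime] [CharP F p] {χ : AddChar F ℂ}
    (hχ : χ.IsPrimitive) (hfrob : ∀ x, χ (x ^ p) = χ x) (hp : p % 3 = 2)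
    (hα : ∀ x : Fˣ, x ∈ Subgroup.zpowers α) (h3 : 3 ∣ Fintype.card F - 1)
    {ε : ℤ} (hε : ε ^ 2 = Fintype.card F) (hε3 : ε % 3 = 1)
    {k : ℕ} (hk : ¬ 3 ∣ k) {g : F} (hg : g = (α : F) ^ k) :
    ∑ w : F × F, cubeIndicator w.1 * cubeIndicator (g * w.2) *
      cubeIndicator (g ^ 2 * (-w.1 - w.2)) =
      ((Fintype.card F : ℝ) - 1) * (Fintype.card F + 1 - 2 * ε) / 27 := by
  have hg0 : g ≠ 0 := by rw [hg]; exact pow_ne_zero _ α.ne_zero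
  have hshift : ∀ (c : F), c ≠ 0 → ∀ z : F,
      ∑ x, (cubeIndicator (c * x) : ℂ) * χ (z * x) = cubicPeriod χ (c ^ 2 * z) := by
    intro c hc z
    have hcube : IsNonzeroCube (c ^ 3) := ⟨Units.mk0 c hc, by simp⟩
    rw [show c ^ 2 * z = c ^ 3 * (c⁻¹ * z) by field_simp, cubicPeriod_mul_cube χ hcube]
    refine Fintype.sum_equiv (Equiv.mulLeft₀ c hc) _ _ fun t => ?_
    change _ = (cubeIndicator (c * t) : ℂ) * χ (c⁻¹ * z * (c * t))
    rw [show c⁻¹ * z * (c * t) = z * t by field_simp]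
  have hval := cubicPeriod_eq_value hχ hfrob hp hα h3 hε hε3
  have h₁ := sum_fourier_mul_fourier_mul_fourier hχ (fun x : F => (cubeIndicator x : ℂ))
    (fun x => (cubeIndicator (g * x) : ℂ)) (fun x => (cubeIndicator (g ^ 2 * x) : ℂ))
  have h₂ : ∀ z : F, (∑ x, (cubeIndicator x : ℂ) * χ (z * x)) *
      (∑ x, (cubeIndicator (g * x) : ℂ) * χ (z * x)) *
      (∑ x, (cubeIndicator (g ^ 2 * x) : ℂ) * χ (z * x)) =
      ((cubicPeriodValue (ε : ℝ) z * cubicPeriodValue (ε : ℝ) (g ^ 2 * z) *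
        cubicPeriodValue (ε : ℝ) ((g ^ 2) ^ 2 * z) : ℝ) : ℂ) := by
    intro z
    rw [hshift g hg0, hshift (g ^ 2) (pow_ne_zero _ hg0)]
    push_cast
    rw [← hval, ← hval, ← hval]
    rfl
  simp_rw [h₂] at h₁
  have h₃ : ∑ z : F, (cubicPeriodValue (ε : ℝ) z * cubicPeriodValue (ε : ℝ) (g ^ 2 * z) *
        cubicPeriodValue (ε : ℝ) ((g ^ 2) ^ 2 * z)) =
      Fintype.card F * ∑ w : F × F, cubeIndicator w.1 * cubeIndicator (g * w.2) *
      cubeIndicator (g ^ 2 * (-w.1 - w.2)) := by exact_mod_cast h₁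
  have h₄ : ∀ z : F, z ≠ 0 → (cubicPeriodValue (ε : ℝ) z * cubicPeriodValue (ε : ℝ) (g ^ 2 * z) *
        cubicPeriodValue (ε : ℝ) ((g ^ 2) ^ 2 * z)) =
        (-1 - 2 * ε) / 3 * (((ε : ℝ) - 1) / 3) ^ 2 := by
    intro z hz
    obtain ⟨i, rfl⟩ := exists_eq_generator_pow hα hz
    rw [hg, ← pow_mul, ← pow_mul, ← pow_add, ← pow_add]
    have hα0 : ∀ j : ℕ, (α : F) ^ j ≠ 0 := fun j => pow_ne_zero _ α.ne_zero
    simp only [cubicPeriodValue, if_neg (hα0 _), isNonzeroCube_generator_pow hα h3]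
    have hcases : 3 ∣ i ∧ ¬ 3 ∣ k * 2 + i ∧ ¬ 3 ∣ k * 2 * 2 + i ∨
        ¬ 3 ∣ i ∧ 3 ∣ k * 2 + i ∧ ¬ 3 ∣ k * 2 * 2 + i ∨
        ¬ 3 ∣ i ∧ ¬ 3 ∣ k * 2 + i ∧ 3 ∣ k * 2 * 2 + i := by
      have hk' : k % 3 = 1 ∨ k % 3 = 2 := by omega
      have hi : i % 3 = 0 ∨ i % 3 = 1 ∨ i % 3 = 2 := by omega
      omega
    rcases hcases with ⟨a, b, c⟩ | ⟨a, b, c⟩ | ⟨a, b, c⟩ <;>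
      simp only [a, b, c, if_true, if_false] <;> ring
  have h₅ := three_mul_sum_of_shift_sum_const (α := α) (fun z : F => cubicPeriodValue (ε : ℝ) z *
    cubicPeriodValue (ε : ℝ) (g ^ 2 * z) * cubicPeriodValue (ε : ℝ) ((g ^ 2) ^ 2 * z))
    (3 * ((-1 - 2 * ε) / 3 * (((ε : ℝ) - 1) / 3) ^ 2)) (by
      intro x hx
      rw [h₄ x hx, h₄ _ (mul_ne_zero α.ne_zero hx),
        h₄ _ (mul_ne_zero (pow_ne_zero _ α.ne_zero) hx)]
      ring)
  rw [h₃] at h₅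
  simp only [mul_zero, cubicPeriodValue, if_true] at h₅
  have hr0 : (Fintype.card F : ℝ) ≠ 0 := by exact_mod_cast Fintype.card_ne_zero
  have hεr : (Fintype.card F : ℝ) = (ε : ℝ) ^ 2 := by exact_mod_cast hε.symm
  refine mul_left_cancel₀ hr0 ?_
  rw [hεr] at h₅ ⊢
  linear_combination h₅ / 3

lemma indicator_relations_of_sum_eq_zero {α : Fˣ}
    (hα : ∀ x : Fˣ, x ∈ Subgroup.zpowers α) (h3 : 3 ∣ Fintype.card F - 1)
    {k : ℕ} (hk : ¬ 3 ∣ k) {g : F} (hg : g = (α : F) ^ k) (x₀ x₁ x₂ : F) (hx : x₀ + x₁ + x₂ = 0) :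
    zeroIndicator x₀ * zeroIndicator (g * x₁) = zeroIndicator x₀ * zeroIndicator (g ^ 2 * x₂) ∧
    zeroIndicator x₀ * zeroIndicator (g * x₁) =
      zeroIndicator (g * x₁) * zeroIndicator (g ^ 2 * x₂) ∧
    zeroIndicator x₀ * (cubeIndicator (g * x₁) * cubeIndicator (g ^ 2 * x₂)) = 0 ∧
    zeroIndicator (g * x₁) * (cubeIndicator x₀ * cubeIndicator (g ^ 2 * x₂)) = 0 ∧
    zeroIndicator (g ^ 2 * x₂) * (cubeIndicator x₀ * cubeIndicator (g * x₁)) = 0 := by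
  have hg0 : g ≠ 0 := by rw [hg]; exact pow_ne_zero _ α.ne_zero
  have hnoncube : ∀ c : F, (c = g ∨ c = g ^ 2) → ∀ x y : F, x + y = 0 →
      cubeIndicator x * cubeIndicator (c * y) = 0 := by
    intro c hc x y hxy
    obtain rfl : y = -x := by linear_combination hxy
    by_cases hx0 : x = 0
    · rw [hx0, cubeIndicator_zero, zero_mul]
    · obtain ⟨i, rfl⟩ := exists_eq_generator_pow hα hx0
      rw [mul_neg, cubeIndicator_congr (isNonzeroCube_neg_iff _)]
      simp only [cubeIndicator]
      rcases hc with rfl | rfl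
      · rw [hg, ← pow_add, isNonzeroCube_generator_pow hα h3, isNonzeroCube_generator_pow hα h3]
        by_cases hi : 3 ∣ i
        · rw [if_neg (show ¬ 3 ∣ k + i by omega), mul_zero]
        · rw [if_neg hi, zero_mul]
      · rw [hg, ← pow_mul, ← pow_add, isNonzeroCube_generator_pow hα h3,
          isNonzeroCube_generator_pow hα h3]
        by_cases hi : 3 ∣ i
        · rw [if_neg (show ¬ 3 ∣ k * 2 + i by omega), mul_zero]
        · rw [if_neg hi, zero_mul]
  rw [zeroIndicator_mul_left hg0, zeroIndicator_mul_left (pow_ne_zero 2 hg0)]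
  refine ⟨?_, ?_, ?_, ?_, ?_⟩
  · by_cases h : x₀ = 0
    · have : x₁ = 0 ↔ x₂ = 0 := by
        constructor <;> intro h' <;> simpa [h, h'] using hx
      simp [zeroIndicator, this]
    · simp [zeroIndicator, h]
  · by_cases h : x₁ = 0
    · have : x₀ = 0 ↔ x₂ = 0 := by
        constructor <;> intro h' <;> simpa [h, h'] using hx
      simp [zeroIndicator, this, h]
    · simp [zeroIndicator, h]
  · by_cases h : x₀ = 0
    · rw [pow_two, mul_assoc, hnoncube g (Or.inl rfl), mul_zero]
      rw [← mul_add]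
      rw [h, zero_add] at hx
      rw [hx, mul_zero]
    · simp [zeroIndicator, h]
  · by_cases h : x₁ = 0
    · rw [hnoncube _ (Or.inr rfl), mul_zero]
      simpa [h] using hx
    · simp [zeroIndicator, h]
  · by_cases h : x₂ = 0
    · rw [hnoncube _ (Or.inl rfl), mul_zero]
      simpa [h] using hx
    · simp [zeroIndicator, h]

lemma sum_cubicPeriodValue_mem {α : Fˣ}
    (hα : ∀ x : Fˣ, x ∈ Subgroup.zpowers α) (h3 : 3 ∣ Fintype.card F - 1)
    {k : ℕ} (hk : ¬ 3 ∣ k) {g : F} (hg : g = (α : F) ^ k) (ε : ℝ) (x₀ x₁ x₂ : F)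
    (hx : x₀ + x₁ + x₂ = 0) :
    cubicPeriodValue ε x₀ + cubicPeriodValue ε (g * x₁) + cubicPeriodValue ε (g ^ 2 * x₂) ∈
      ({-1 - 2 * ε, ε - 1, -1 - ε, -1, ((Fintype.card F : ℝ) + 2 * ε - 3) / 3,
        ((Fintype.card F : ℝ) - ε - 3) / 3, (Fintype.card F : ℝ) - 1} : Set ℝ) := by
  obtain ⟨hd₁, hd₂, hu₀, hu₁, hu₂⟩ := indicator_relations_of_sum_eq_zero hα h3 hk hg x₀ x₁ x₂ hx
  by_contra hnot
  have h := apply_sum_periods_eq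
    (fun t => if t ∈ ({-1 - 2 * ε, ε - 1, -1 - ε, -1, ((Fintype.card F : ℝ) + 2 * ε - 3) / 3,
        ((Fintype.card F : ℝ) - ε - 3) / 3, (Fintype.card F : ℝ) - 1} : Set ℝ) then 0 else 1)
    (Fintype.card F) ε _ _ _ _ _ _ (indicator_cases _) (indicator_cases _) (indicator_cases _)
    hd₁ hd₂ hu₀ hu₁ hu₂
  rw [← cubicPeriodValue_eq, ← cubicPeriodValue_eq, ← cubicPeriodValue_eq, if_neg hnot] at h
  simp at h

/-- Distribution of the sums of periods over the triples of elements with sum zero. -/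
lemma sum_apply_cubicPeriodValue {α : Fˣ} {p : ℕ} [Fact p.Prime] [CharP F p] {χ : AddChar F ℂ}
    (hχ : χ.IsPrimitive) (hfrob : ∀ x, χ (x ^ p) = χ x) (hp : p % 3 = 2)
    (hα : ∀ x : Fˣ, x ∈ Subgroup.zpowers α) (h3 : 3 ∣ Fintype.card F - 1)
    {ε : ℤ} (hε : ε ^ 2 = Fintype.card F) (hε3 : ε % 3 = 1)
    {k : ℕ} (hk : ¬ 3 ∣ k) {g : F} (hg : g = (α : F) ^ k) (r : ℝ) (hr : r = Fintype.card F)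
    (Φ : ℝ → ℝ) :
    ∑ w : F × F, Φ (cubicPeriodValue (ε : ℝ) w.1 + cubicPeriodValue (ε : ℝ) (g * w.2) +
        cubicPeriodValue (ε : ℝ) (g ^ 2 * (-w.1 - w.2))) =
      (r - 1) * (r + 1 - 2 * ε) / 27 * Φ (-1 - 2 * ε) +
      2 * (r - 1) * (4 * r - 5 + ε) / 27 * Φ (ε - 1) +
      2 * (r - 1) * (r - 2 + ε) / 9 * Φ (-1 - ε) +
      (r - 1) * (4 * r - 11 - 2 * ε) / 9 * Φ (-1) +
      (r - 1) * Φ ((r + 2 * ε - 3) / 3) +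
      2 * (r - 1) * Φ ((r - ε - 3) / 3) +
      Φ (r - 1) := by
  have hg0 : g ≠ 0 := by rw [hg]; exact pow_ne_zero _ α.ne_zero
  have hg20 : g ^ 2 ≠ 0 := pow_ne_zero _ hg0
  have key : ∀ w : F × F, _ := fun w => by
    obtain ⟨hd₁, hd₂, hu₀, hu₁, hu₂⟩ := indicator_relations_of_sum_eq_zero hα h3 hk hg
      w.1 w.2 (-w.1 - w.2) (by ring)
    exact apply_sum_periods_eq Φ r ε _ _ _ _ _ _ (indicator_cases _) (indicator_cases _)
      (indicator_cases _) hd₁ hd₂ hu₀ hu₁ hu₂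
  have su : ∑ x : F, cubeIndicator x = (r - 1) / 3 := by rw [hr, sum_cubeIndicator hα h3]
  have su₁ : ∑ x : F, cubeIndicator (g * x) = (r - 1) / 3 := by
    rw [sum_comp_mul_left hg0 cubeIndicator, su]
  have su₂ : ∑ x : F, cubeIndicator (g ^ 2 * x) = (r - 1) / 3 := by
    rw [sum_comp_mul_left hg20 cubeIndicator, su]
  have sd := sum_zeroIndicator (F := F)
  have e1 : ∑ _w : F × F, (1 : ℝ) = r * r := by simp [hr]
  have single₀ : ∀ f : F → ℝ, ∑ w : F × F, f w.1 = (∑ x, f x) * r := by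
    intro f
    simpa [hr] using sum_prod_mul_fst_snd f fun _ => 1
  have single₁ : ∀ f : F → ℝ, ∑ w : F × F, f w.2 = (∑ x, f x) * r := by
    intro f
    simpa [hr, mul_comm] using sum_prod_mul_fst_snd (fun _ => 1) f
  have single₂ : ∀ f : F → ℝ, ∑ w : F × F, f (-w.1 - w.2) = (∑ x, f x) * r := by
    intro f
    simpa [hr, mul_comm] using sum_prod_mul_fst_neg (fun _ => 1) f
  have pair₁₀ : ∀ f₀ f₁ : F → ℝ, ∑ w : F × F, f₁ w.2 * f₀ w.1 = (∑ x, f₁ x) * ∑ x, f₀ x := by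
    intro f₀ f₁
    simpa [mul_comm] using sum_prod_mul_fst_snd f₀ f₁
  have pair₂₀ : ∀ f₀ f₁ : F → ℝ, ∑ w : F × F, f₁ (-w.1 - w.2) * f₀ w.1 =
      (∑ x, f₁ x) * ∑ x, f₀ x := by
    intro f₀ f₁
    simpa [mul_comm] using sum_prod_mul_fst_neg f₀ f₁
  have pair₂₁ : ∀ f₀ f₁ : F → ℝ, ∑ w : F × F, f₁ (-w.1 - w.2) * f₀ w.2 =
      (∑ x, f₁ x) * ∑ x, f₀ x := by
    intro f₀ f₁
    simpa [mul_comm] using sum_prod_mul_snd_neg f₀ f₁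
  have triple := sum_cubeIndicator_triple hχ hfrob hp hα h3 hε hε3 hk hg
  rw [← hr] at triple
  simp_rw [cubicPeriodValue_eq, ← hr, key, zeroIndicator_mul_left hg0, zeroIndicator_mul_left hg20]
  simp only [Finset.sum_add_distrib, Finset.sum_sub_distrib, ← Finset.sum_mul, ← Finset.mul_sum]
  rw [triple, e1, single₀ cubeIndicator, single₁ fun x => cubeIndicator (g * x),
    single₂ fun x => cubeIndicator (g ^ 2 * x),
    sum_prod_mul_fst_snd cubeIndicator fun x => cubeIndicator (g * x),
    sum_prod_mul_fst_neg cubeIndicator fun x => cubeIndicator (g ^ 2 * x),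
    sum_prod_mul_snd_neg (fun x => cubeIndicator (g * x)) fun x => cubeIndicator (g ^ 2 * x),
    single₀ zeroIndicator, single₁ zeroIndicator, single₂ zeroIndicator,
    sum_prod_mul_fst_snd zeroIndicator zeroIndicator,
    sum_prod_mul_fst_snd zeroIndicator fun x => cubeIndicator (g * x),
    sum_prod_mul_fst_neg zeroIndicator fun x => cubeIndicator (g ^ 2 * x),
    pair₁₀ cubeIndicator zeroIndicator,
    sum_prod_mul_snd_neg zeroIndicator fun x => cubeIndicator (g ^ 2 * x),
    pair₂₀ cubeIndicator zeroIndicator,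
    pair₂₁ (fun x => cubeIndicator (g * x)) zeroIndicator, su, su₁, su₂, sd]
  ring

end Counting

section TraceCount

lemma sum_range_mul_three {M : Type*} [AddCommMonoid M] (f : ℕ → M) (n : ℕ) :
    ∑ i ∈ Finset.range (3 * n), f i =
      ∑ i ∈ Finset.range n, (f (3 * i) + f (3 * i + 1) + f (3 * i + 2)) := by
  induction n with
  | zero => simp
  | succ n ih =>
    rw [Finset.sum_range_succ, ← ih, show 3 * (n + 1) = 3 * n + 1 + 1 + 1 by ring,
      Finset.sum_range_succ, Finset.sum_range_succ, Finset.sum_range_succ]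
    simp only [add_assoc]

lemma sum_zpowers_eq_sum_range {G : Type*} [Group G] [Fintype G] (γ : G) (f : G → ℂ) :
    ∑ y : Subgroup.zpowers γ, f y = ∑ i ∈ Finset.range (orderOf γ), f (γ ^ i) := by
  rw [Finset.sum_range]
  exact (Fintype.sum_equiv (finEquivZPowers (isOfFinOrder_of_finite γ)) _ _ fun _ => rfl).symm

lemma sum_zpowers_cube {F : Type} [Field F] [Fintype F] {α : Fˣ} (f : F → ℂ)
    (hα : ∀ x : Fˣ, x ∈ Subgroup.zpowers α) :
    ∑ y : Subgroup.zpowers (α ^ 3), f ((y : Fˣ) : F) = ∑ t, (cubeIndicator t : ℂ) * f t := by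
  have h : ∀ t : F, (cubeIndicator t : ℂ) * f t = if IsNonzeroCube t then f t else 0 := by
    intro t
    unfold cubeIndicator
    split_ifs <;> simp
  simp_rw [h]
  rw [← Finset.sum_filter]
  refine Finset.sum_bij (fun y _ => ((y : Fˣ) : F)) ?_ ?_ ?_ ?_
  · rintro ⟨y, i, rfl⟩ _
    simp only [Finset.mem_filter, Finset.mem_univ, true_and]
    exact ⟨α ^ i, by rw [← zpow_natCast, ← zpow_natCast, zpow_comm]⟩
  · intro y _ y' _ hy
    exact Subtype.ext (Units.ext hy)
  · intro t ht
    obtain ⟨y, rfl⟩ := (Finset.mem_filter.1 ht).2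
    obtain ⟨i, rfl⟩ := hα y
    exact ⟨⟨(α ^ i) ^ 3, i, by rw [← zpow_natCast, ← zpow_natCast, zpow_comm]⟩,
      Finset.mem_univ _, rfl⟩
  · intro _ _
    rfl

variable {K F : Type} [Field K] [Field F] [Algebra K F] [Fintype K]

lemma card_mul_indicator_trace_eq_zero {ψ : AddChar K ℂ} {χ : AddChar F ℂ} (hψ : ψ.IsPrimitive)
    (htrace : ∀ x, χ x = ψ (Algebra.trace K F x)) (c : F) :
    (Fintype.card K : ℂ) * (if Algebra.trace K F c = 0 then 1 else 0) =
      1 + ∑ z : Kˣ, χ (algebraMap K F z * c) := by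
  have h₁ := AddChar.sum_mulShift (Algebra.trace K F c) hψ
  have h₂ : ∀ z : K, ψ (z * Algebra.trace K F c) = χ (algebraMap K F z * c) := by
    intro z
    rw [htrace, ← Algebra.smul_def, map_smul, smul_eq_mul]
  simp_rw [h₂] at h₁
  rw [Fintype.sum_eq_add_sum_subtype_ne _ 0] at h₁
  rw [← Fintype.sum_equiv unitsEquivNeZero (fun z : Kˣ => χ (algebraMap K F z * c)) _ fun _ => rfl]
    at h₁
  rw [map_zero, zero_mul, AddChar.map_zero_eq_one] at h₁
  rw [h₁]
  push_cast
  split_ifs <;> simp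

variable [Fintype F] {α : Fˣ}

lemma range_units_map_algebraMap {A : ℕ} (hA : 0 < A)
    (hcard : Fintype.card F - 1 = (Fintype.card K - 1) * A)
    (hα : ∀ x : Fˣ, x ∈ Subgroup.zpowers α) :
    (Units.map (algebraMap K F).toMonoidHom).range = Subgroup.zpowers (α ^ A) := by
  have hq1 : 0 < Fintype.card K - 1 := by have := Fintype.one_lt_card (α := K); omega
  have horder : orderOf (α ^ A) = Fintype.card K - 1 := by
    rw [orderOf_pow_of_dvd hA.ne' (by rw [orderOf_generator hα, hcard]; exact Dvd.intro_left _ rfl),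
      orderOf_generator hα, hcard, Nat.mul_div_cancel _ hA]
  have hinj : Function.Injective (Units.map (algebraMap K F).toMonoidHom) :=
    Units.map_injective (algebraMap K F).injective
  apply Subgroup.eq_of_le_of_card_ge
  · rintro _ ⟨z, rfl⟩
    obtain ⟨i, hi⟩ := (mem_powers_iff_mem_zpowers (x := α)).2
      (hα (Units.map (algebraMap K F).toMonoidHom z))
    have hz : z ^ (Fintype.card K - 1) = 1 := by
      rw [← Fintype.card_units, pow_card_eq_one]
    have hpow : α ^ (i * (Fintype.card K - 1)) = 1 := by
      rw [pow_mul]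
      change (fun n => α ^ n) i ^ _ = 1
      rw [hi, ← map_pow, hz, map_one]
    have hdvd := orderOf_dvd_of_pow_eq_one hpow
    rw [orderOf_generator hα, hcard, mul_comm i] at hdvd
    obtain ⟨j, rfl⟩ := Nat.dvd_of_mul_dvd_mul_left hq1 hdvd
    rw [← hi]
    exact ⟨j, by simp [pow_mul]⟩
  · rw [Nat.card_zpowers, horder, Nat.card_congr (MonoidHom.ofInjective hinj).toEquiv.symm,
      Nat.card_eq_fintype_card, Fintype.card_units]

/-- The products of a nonzero element of the small field with a power of `α ^ (3 * k)` cover the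
nonzero cubes uniformly. -/
lemma sum_range_sum_units_eq {h k A : ℕ} (hA : 0 < A)
    (hcard : Fintype.card F - 1 = (Fintype.card K - 1) * (3 * A))
    (hkh : Fintype.card K - 1 = k * h) (hgcd : Nat.gcd (3 * A) (3 * k) = 3)
    (hα : ∀ x : Fˣ, x ∈ Subgroup.zpowers α) (f : F → ℂ) :
    ∑ i ∈ Finset.range (h * A), ∑ z : Kˣ, f (algebraMap K F z * ((α : F) ^ (3 * k)) ^ i) =
      h * ∑ t, (cubeIndicator t : ℂ) * f t := by
  have hq1 : 0 < Fintype.card K - 1 := by have := Fintype.one_lt_card (α := K); omega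
  have hk : 0 < k := by
    rcases Nat.eq_zero_or_pos k with rfl | hk
    · omega
    · exact hk
  have hrange := range_units_map_algebraMap (K := K) (A := 3 * A) (by omega) hcard hα
  have horderγ : orderOf (α ^ (3 * k)) = h * A := by
    have hr : Fintype.card F - 1 = h * A * (3 * k) := by rw [hcard, hkh]; ring
    rw [orderOf_pow_of_dvd (by omega)
        (by rw [orderOf_generator hα, hr]; exact Dvd.intro_left _ rfl),
      orderOf_generator hα, hr, Nat.mul_div_cancel _ (by omega)]
  have horder3 : orderOf (α ^ 3) = (Fintype.card K - 1) * A := by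
    have hr : Fintype.card F - 1 = (Fintype.card K - 1) * A * 3 := by rw [hcard]; ring
    rw [orderOf_pow_of_dvd (by omega)
        (by rw [orderOf_generator hα, hr]; exact Dvd.intro_left _ rfl),
      orderOf_generator hα, hr, Nat.mul_div_cancel _ (by omega)]
  have hranges : ((Units.map (algebraMap K F).toMonoidHom).coprod
      (Subgroup.zpowers (α ^ (3 * k))).subtype).range =
        (Subgroup.zpowers (α ^ 3)).subtype.range := by
    rw [Subgroup.range_subtype]
    apply le_antisymm
    · rintro _ ⟨⟨z, y⟩, rfl⟩
      rw [MonoidHom.coprod_apply]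
      refine mul_mem ?_ ?_
      · have hz : Units.map (algebraMap K F).toMonoidHom z ∈ Subgroup.zpowers (α ^ (3 * A)) :=
          hrange ▸ ⟨z, rfl⟩
        refine Subgroup.zpowers_le.2 ?_ hz
        rw [pow_mul]
        exact Subgroup.npow_mem_zpowers _ _
      · refine Subgroup.zpowers_le.2 ?_ y.2
        rw [pow_mul]
        exact Subgroup.npow_mem_zpowers _ _
    · rw [Subgroup.zpowers_le]
      obtain ⟨z, hz⟩ : (α ^ (3 * A)) ^ Nat.gcdA (3 * A) (3 * k) ∈
          (Units.map (algebraMap K F).toMonoidHom).range :=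
        hrange ▸ Subgroup.zpow_mem_zpowers _ _
      refine ⟨⟨z, ⟨(α ^ (3 * k)) ^ Nat.gcdB (3 * A) (3 * k), Subgroup.zpow_mem_zpowers _ _⟩⟩, ?_⟩
      rw [MonoidHom.coprod_apply, hz]
      change (α ^ (3 * A)) ^ Nat.gcdA (3 * A) (3 * k) *
        (α ^ (3 * k)) ^ Nat.gcdB (3 * A) (3 * k) = α ^ 3
      rw [← zpow_natCast, ← zpow_natCast, ← zpow_mul, ← zpow_mul, ← zpow_add,
        ← Nat.gcd_eq_gcd_ab, hgcd, zpow_natCast]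
  have h₁ := card_mul_sum_comp_eq_of_range_eq _ _ hranges fun y => f (y : F)
  rw [Fintype.card_prod, Fintype.card_units, Fintype.card_zpowers, Fintype.card_zpowers, horderγ,
    horder3, Fintype.sum_prod_type_right] at h₁
  simp only [MonoidHom.coprod_apply, Subgroup.subtype_apply, sum_zpowers_cube f hα] at h₁
  rw [sum_zpowers_eq_sum_range (α ^ (3 * k)) fun y => ∑ z : Kˣ,
    f ((Units.map (algebraMap K F).toMonoidHom z * y : Fˣ) : F), horderγ] at h₁
  have hne : (((Fintype.card K - 1) * A : ℕ) : ℂ) ≠ 0 := by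
    exact_mod_cast (Nat.mul_pos hq1 hA).ne'
  refine mul_left_cancel₀ hne ?_
  have hmul : ((Fintype.card K - 1) * (h * A) : ℕ) = ((Fintype.card K - 1) * A) * h := by ring
  rw [hmul, Nat.cast_mul _ h, mul_assoc] at h₁
  simpa using h₁

/-- The number of vanishing coordinates of a codeword in terms of cubic Gaussian periods. -/
lemma card_mul_ncard_trace_ne_zero {ψ : AddChar K ℂ} {χ : AddChar F ℂ} (hψ : ψ.IsPrimitive)
    (htrace : ∀ x, χ x = ψ (Algebra.trace K F x))
    {h k A : ℕ} (hA : 0 < A)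
    (hcard : Fintype.card F - 1 = (Fintype.card K - 1) * (3 * A))
    (hkh : Fintype.card K - 1 = k * h) (hgcd : Nat.gcd (3 * A) (3 * k) = 3)
    (hα : ∀ x : Fˣ, x ∈ Subgroup.zpowers α) {g β : F} (hg : g = (α : F) ^ k) (hβ : β ^ 3 = 1)
    (a b : F) :
    (Fintype.card K : ℂ) * ((3 * (h * A) : ℕ) - (Set.ncard {i : Fin (3 * (h * A)) |
        Algebra.trace K F (a * g ^ (i : ℕ) + b * (β * g) ^ (i : ℕ)) ≠ 0} : ℂ)) =
      (3 * (h * A) : ℕ) + h * (cubicPeriod χ (a + b) + cubicPeriod χ (g * (a + b * β)) +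
        cubicPeriod χ (g ^ 2 * (a + b * β ^ 2))) := by
  have hcount : ((3 * (h * A) : ℕ) : ℂ) - (Set.ncard {i : Fin (3 * (h * A)) |
        Algebra.trace K F (a * g ^ (i : ℕ) + b * (β * g) ^ (i : ℕ)) ≠ 0} : ℂ) =
      ∑ i ∈ Finset.range (3 * (h * A)),
        if Algebra.trace K F (a * g ^ i + b * (β * g) ^ i) = 0 then (1 : ℂ) else 0 := by
    rw [Finset.sum_range fun i =>
        if Algebra.trace K F (a * g ^ i + b * (β * g) ^ i) = 0 then (1 : ℂ) else 0,
      Set.ncard_eq_toFinset_card', Finset.sum_boole, sub_eq_iff_eq_add, ← Nat.cast_add]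
    have := Finset.card_filter_add_card_filter_not (s := (Finset.univ : Finset (Fin (3 * (h * A)))))
      (fun i => Algebra.trace K F (a * g ^ (i : ℕ) + b * (β * g) ^ (i : ℕ)) = 0)
    rw [Finset.card_univ, Fintype.card_fin] at this
    rw [Set.toFinset_ofPred, this]
  rw [hcount, Finset.mul_sum]
  simp_rw [card_mul_indicator_trace_eq_zero hψ htrace]
  rw [Finset.sum_add_distrib, Finset.sum_const, Finset.card_range, nsmul_one,
    sum_range_mul_three, Finset.sum_add_distrib, Finset.sum_add_distrib]
  congr 1
  have hterm : ∀ (j : ℕ) (d : F), d = g ^ j * (a + b * β ^ j) →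
      ∑ i ∈ Finset.range (h * A), ∑ z : Kˣ,
        χ (algebraMap K F z * (a * g ^ (3 * i + j) + b * (β * g) ^ (3 * i + j))) =
        h * cubicPeriod χ d := by
    intro j d hd
    rw [cubicPeriod, ← sum_range_sum_units_eq hA hcard hkh hgcd hα fun t => χ (d * t)]
    refine Finset.sum_congr rfl fun i _ => Finset.sum_congr rfl fun z _ => ?_
    congr 1
    have hβi : β ^ (3 * i + j) = β ^ j := by rw [pow_add, pow_mul, hβ, one_pow, one_mul]
    have hgi : ((α : F) ^ (3 * k)) ^ i = g ^ (3 * i) := by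
      rw [hg, ← pow_mul, ← pow_mul]
      ring_nf
    rw [mul_pow, hβi, hgi, hd, pow_add]
    ring
  have t₀ := hterm 0 (a + b) (by simp)
  have t₁ := hterm 1 (g * (a + b * β)) (by simp)
  have t₂ := hterm 2 (g ^ 2 * (a + b * β ^ 2)) rfl
  simp only [add_zero] at t₀
  rw [t₀, t₁, t₂]
  ring

end TraceCount

lemma cubicPeriodValue_mul_mul_cube {F : Type} [Field F] [Fintype F] (ε : ℝ) {c : F}
    (hc : IsNonzeroCube c) (g x : F) :
    cubicPeriodValue ε (g * (c * x)) = cubicPeriodValue ε (g * x) := by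
  rw [mul_left_comm, cubicPeriodValue, cubicPeriodValue]
  simp only [hc.mul_iff, mul_eq_zero, hc.ne_zero, false_or]

/-- STATEMENT 0: Weight distribution of `C_{(q,m,h,3)}` for `e = N = 3`,
`p ≡ 2 (mod 3)` (p = 2 allowed) and `3 ∤ (q−1)/h` (Table 2). -/
theorem stmt_1 (p s m h : ℕ) (hp : p.Prime) (hp3 : p % 3 = 2) (hs : 1 ≤ s) (hm : 1 ≤ m)
    (q r : ℕ) (hq : q = p ^ s) (hr : r = q ^ m)
    (hh : 0 < h) (hhq : h ∣ q - 1)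
    (he : 3 ∣ Nat.gcd (q - 1) (h * m))
    (hN : Nat.gcd ((r - 1) / (q - 1)) (3 * (q - 1) / h) = 3)
    (hdvd : ¬ 3 ∣ (q - 1) / h)
    (K F : Type) [Field K] [Field F] [Algebra K F] [Fintype K] [Fintype F]
    (hcardK : Fintype.card K = q) (hcardF : Fintype.card F = r)
    (α : Fˣ) (hα : ∀ x : Fˣ, x ∈ Subgroup.zpowers α)
    (g β : F) (hg : g = (α : F) ^ ((q - 1) / h)) (hβ : β = (α : F) ^ ((r - 1) / 3))
    (n : ℕ) (hn : n = h * (r - 1) / (q - 1))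
    (lam : F → F → ℝ)
    (hlam : ∀ a b : F, lam a b = (h : ℝ) * ((r : ℝ) - 1) / q -
      (Set.ncard {i : Fin n |
        Algebra.trace K F (a * g ^ (i : ℕ) + b * (β * g) ^ (i : ℕ)) ≠ 0} : ℝ)) :
    Even (m * s) ∧
    ∀ ε : ℝ, ε = (-1 : ℝ) ^ (m * s / 2) * (p : ℝ) ^ (m * s / 2) →
      (∀ a b : F,
        lam a b = -((h : ℝ) * (2 * ε + 1)) / q ∨
        lam a b = (h : ℝ) * (ε - 1) / q ∨
        lam a b = -((h : ℝ) * (ε + 1)) / q ∨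
        lam a b = -(h : ℝ) / q ∨
        lam a b = (h : ℝ) * ((r : ℝ) + 2 * ε - 3) / (3 * q) ∨
        lam a b = (h : ℝ) * ((r : ℝ) - ε - 3) / (3 * q) ∨
        lam a b = (h : ℝ) * ((r : ℝ) - 1) / q) ∧
      (∀ x : ℝ, (Set.ncard {ab : F × F | lam ab.1 ab.2 = x} : ℝ) =
        (if -((h : ℝ) * (2 * ε + 1)) / q = x then
          ((r : ℝ) - 1) * ((r : ℝ) + 1 - 2 * ε) / 27 else 0) +
        (if (h : ℝ) * (ε - 1) / q = x then
          2 * ((r : ℝ) - 1) * (4 * (r : ℝ) - 5 + ε) / 27 else 0) +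
        (if -((h : ℝ) * (ε + 1)) / q = x then
          2 * ((r : ℝ) - 1) * ((r : ℝ) - 2 + ε) / 9 else 0) +
        (if -(h : ℝ) / q = x then
          ((r : ℝ) - 1) * (4 * (r : ℝ) - 11 - 2 * ε) / 9 else 0) +
        (if (h : ℝ) * ((r : ℝ) + 2 * ε - 3) / (3 * q) = x then (r : ℝ) - 1 else 0) +
        (if (h : ℝ) * ((r : ℝ) - ε - 3) / (3 * q) = x then 2 * ((r : ℝ) - 1) else 0) +
        (if (h : ℝ) * ((r : ℝ) - 1) / q = x then 1 else 0)) := by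
  have hfact : Fact p.Prime := ⟨hp⟩
  have hq2 : 2 ≤ q := by
    rw [hq]
    exact hp.two_le.trans (Nat.le_self_pow (by omega) p)
  have h3q : 3 ∣ q - 1 := he.trans (Nat.gcd_dvd_left _ _)
  have hs_even : Even s := by
    by_contra hodd
    rw [Nat.not_even_iff_odd] at hodd
    have hmod : q % 3 = 2 := by
      obtain ⟨t, rfl⟩ := hodd
      rw [hq, pow_succ, pow_mul, Nat.mul_mod, Nat.pow_mod, Nat.pow_mod p, hp3]
      norm_num
    omega
  have hms : Even (m * s) := hs_even.mul_left m
  refine ⟨hms, fun ε hε => ?_⟩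
  obtain ⟨k, hk⟩ := hhq
  have hkdef : (q - 1) / h = k := by rw [hk, Nat.mul_div_cancel_left _ hh]
  rw [hkdef] at hdvd hg
  obtain ⟨B, hB⟩ : q - 1 ∣ r - 1 := by
    rw [hr]
    simpa using Nat.sub_dvd_pow_sub_pow q 1 m
  have hBdef : (r - 1) / (q - 1) = B := by rw [hB, Nat.mul_div_cancel_left _ (by omega)]
  have h3k : 3 * (q - 1) / h = 3 * k := by
    rw [hk, mul_left_comm, Nat.mul_div_cancel_left _ hh]
  rw [hBdef, h3k] at hN
  obtain ⟨A, rfl⟩ : 3 ∣ B := hN ▸ Nat.gcd_dvd_left _ _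
  have hr2 : 2 ≤ r := by
    rw [hr]
    exact hq2.trans (Nat.le_self_pow (by omega) q)
  have hA : 0 < A := by
    rcases Nat.eq_zero_or_pos A with rfl | hA
    · omega
    · exact hA
  have hn' : n = 3 * (h * A) := by
    rw [hn, hB, mul_left_comm, Nat.mul_div_cancel_left _ (by omega)]
    ring
  subst hn'
  have hcharK : CharP K p := charP_of_card_eq_prime_pow (hcardK.trans hq)
  have hr_pow : r = p ^ (m * s) := by rw [hr, hq, ← pow_mul, mul_comm]
  have hcharF : CharP F p := charP_of_card_eq_prime_pow (hcardF.trans hr_pow)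
  obtain ⟨ψ, χ, hψ, hχ, htrace, hfrob⟩ := exists_primitive_addChar_frobenius_invariant K F p
  have hcard3 : 3 ∣ Fintype.card F - 1 := by
    rw [hcardF, hB]
    exact h3q.mul_right _
  obtain ⟨L, hL⟩ := hms
  have hL2 : m * s / 2 = L := by omega
  rw [hL2] at hε
  obtain ⟨e, rfl, hesq, he3⟩ : ∃ e : ℤ, ε = (e : ℝ) ∧ e ^ 2 = Fintype.card F ∧ e % 3 = 1 := by
    refine ⟨(-(p : ℤ)) ^ L, ?_, ?_, ?_⟩
    · rw [hε, ← mul_pow]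
      push_cast
      ring
    · rw [hcardF, hr_pow, hL, ← pow_mul, mul_comm L 2, pow_mul, neg_sq, ← pow_mul]
      push_cast
      ring
    · have h1 : -(p : ℤ) ≡ 1 [ZMOD 3] := by
        unfold Int.ModEq
        omega
      simpa [Int.ModEq] using h1.pow L
  have hβcube : IsNonzeroCube β := by
    rw [hβ, isNonzeroCube_generator_pow hα hcard3, hB, mul_left_comm,
      Nat.mul_div_cancel_left _ (by norm_num)]
    exact h3q.mul_right _
  have hr3 : (r - 1) / 3 * 3 = r - 1 := Nat.div_mul_cancel (hcardF ▸ hcard3)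
  have hβ3 : β ^ 3 = 1 := by
    rw [hβ, ← pow_mul, hr3, ← hcardF]
    exact FiniteField.pow_card_sub_one_eq_one _ α.ne_zero
  have hβ1 : β ≠ 1 := by
    rw [hβ]
    intro h1
    have h1' : α ^ ((r - 1) / 3) = 1 := Units.ext (by simpa using h1)
    have := orderOf_dvd_of_pow_eq_one h1'
    rw [orderOf_generator hα, hcardF] at this
    have := Nat.le_of_dvd (by omega) this
    omega
  have hβsum : 1 + β + β ^ 2 = 0 := by
    have : (β - 1) * (1 + β + β ^ 2) = 0 := by linear_combination hβ3
    exact (mul_eq_zero.1 this).resolve_left (sub_ne_zero.2 hβ1)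
  let T : F × F → F × F := fun ab => (ab.1 + ab.2, β * (ab.1 + ab.2 * β))
  have hTinj : Function.Injective T := by
    rintro ⟨a, b⟩ ⟨a', b'⟩ hT
    obtain ⟨h₁, h₂⟩ := Prod.mk.inj hT
    have h₂' := mul_left_cancel₀ hβcube.ne_zero h₂
    have hb : (β - 1) * (b - b') = 0 := by linear_combination h₂' - h₁
    have hb' : b = b' := sub_eq_zero.1 ((mul_eq_zero.1 hb).resolve_left (sub_ne_zero.2 hβ1))
    subst hb'
    exact Prod.ext (add_right_cancel h₁) rfl
  have hTbij : Function.Bijective T := Finite.injective_iff_bijective.1 hTinj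
  have hq0 : (q : ℝ) ≠ 0 := by
    have : q ≠ 0 := by omega
    exact_mod_cast this
  have hformula : ∀ ab : F × F, lam ab.1 ab.2 = (h : ℝ) / q *
      (cubicPeriodValue (e : ℝ) (T ab).1 + cubicPeriodValue (e : ℝ) (g * (T ab).2) +
        cubicPeriodValue (e : ℝ) (g ^ 2 * (-(T ab).1 - (T ab).2))) := by
    rintro ⟨a, b⟩
    have hweight := card_mul_ncard_trace_ne_zero hψ htrace hA (by rw [hcardF, hcardK, hB])
      (by rw [hcardK, hk, mul_comm]) hN hα hg hβ3 a b
    simp only [cubicPeriod_eq_value hχ hfrob hp3 hα hcard3 hesq he3] at hweight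
    have hx₂ : -(T (a, b)).1 - (T (a, b)).2 = β ^ 2 * (a + b * β ^ 2) := by
      simp only [T]
      linear_combination -(a + b) * hβsum - b * β * hβ3
    have hβ2cube : IsNonzeroCube (β ^ 2) := by
      rw [pow_two]
      exact (hβcube.mul_iff _).2 hβcube
    rw [hx₂, cubicPeriodValue_mul_mul_cube _ hβ2cube, hlam]
    simp only [T]
    rw [cubicPeriodValue_mul_mul_cube _ hβcube]
    rw [hcardK] at hweight
    have hweightR : (q : ℝ) * ((3 * (h * A) : ℕ) - (Set.ncard {i : Fin (3 * (h * A)) |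
        Algebra.trace K F (a * g ^ (i : ℕ) + b * (β * g) ^ (i : ℕ)) ≠ 0} : ℝ)) =
        (3 * (h * A) : ℕ) + h * (cubicPeriodValue (e : ℝ) (a + b) +
          cubicPeriodValue (e : ℝ) (g * (a + b * β)) +
          cubicPeriodValue (e : ℝ) (g ^ 2 * (a + b * β ^ 2))) := by
      exact_mod_cast hweight
    have hrR : (r : ℝ) - 1 = (q - 1) * (3 * A) := by
      have : ((r - 1 : ℕ) : ℝ) = ((q - 1 : ℕ) : ℝ) * (3 * A) := by exact_mod_cast hB
      rwa [Nat.cast_sub (by omega), Nat.cast_sub (by omega), Nat.cast_one] at this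
    rw [hrR]
    field_simp
    push_cast at hweightR
    linear_combination hweightR
  have hv₁ : -((h : ℝ) * (2 * e + 1)) / q = h / q * (-1 - 2 * e) := by ring
  have hv₂ : (h : ℝ) * (e - 1) / q = h / q * (e - 1) := by ring
  have hv₃ : -((h : ℝ) * (e + 1)) / q = h / q * (-1 - e) := by ring
  have hv₄ : -(h : ℝ) / q = h / q * (-1) := by ring
  have hv₅ : (h : ℝ) * ((r : ℝ) + 2 * e - 3) / (3 * q) = h / q * ((r + 2 * e - 3) / 3) := by
    field_simp
  have hv₆ : (h : ℝ) * ((r : ℝ) - e - 3) / (3 * q) = h / q * ((r - e - 3) / 3) := by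
    field_simp
  have hv₇ : (h : ℝ) * ((r : ℝ) - 1) / q = h / q * (r - 1) := by ring
  rw [hv₁, hv₂, hv₃, hv₄, hv₅, hv₆, hv₇]
  constructor
  · intro a b
    have hmem := sum_cubicPeriodValue_mem hα hcard3 hdvd hg e (T (a, b)).1 (T (a, b)).2
      (-(T (a, b)).1 - (T (a, b)).2) (by ring)
    rw [hcardF] at hmem
    rw [hformula (a, b)]
    rcases hmem with h | h | h | h | h | h | h <;> rw [h] <;> simp
  · intro x
    have hcount : (Set.ncard {ab : F × F | lam ab.1 ab.2 = x} : ℝ) =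
        ∑ ab : F × F, if lam ab.1 ab.2 = x then (1 : ℝ) else 0 := by
      rw [Set.ncard_eq_toFinset_card', Set.toFinset_ofPred, Finset.sum_boole]
    rw [hcount]
    simp_rw [hformula]
    rw [hTbij.sum_comp fun w : F × F => if (h : ℝ) / q * (cubicPeriodValue (e : ℝ) w.1 +
        cubicPeriodValue (e : ℝ) (g * w.2) +
        cubicPeriodValue (e : ℝ) (g ^ 2 * (-w.1 - w.2))) = x then (1 : ℝ) else 0,
      sum_apply_cubicPeriodValue hχ hfrob hp3 hα hcard3 hesq he3 hdvd hg r (by rw [hcardF])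
        fun t => if (h : ℝ) / q * t = x then (1 : ℝ) else 0]
    simp only [mul_ite, mul_one, mul_zero]
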